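/- Let Φ be the linear functional on ℚ(q)[z] with Φ([n,z choose n]_q) = 1/(-q^2;q)_n, and let P_{1,n}(z) be the specialized big q-Jacobi polynomials with ℓ = 1. Then Φ(z · P_{1,n}(z)) = 0 for every n ≥ 1. -/

import Mathlib

open Finset Polynomial

noncomputable def q : RatFunc ℚ := RatFunc.X

/-- q-integer `[k]_q = (1-q^k)/(1-q)` for `k : ℤ`. -/
noncomputable def qint (k : ℤ) : RatFunc ℚ := (1 - q ^ k) / (1 - q)

/-- q-factorial `[n]_q!`. -/
noncomputable def qfact (n : ℕ) : RatFunc ℚ := ∏ m ∈ Finset.range n, qint (m + 1)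

/-- q-Pochhammer `(A;Q)_n`. -/
noncomputable def qPoch (Q A : RatFunc ℚ) (n : ℕ) : RatFunc ℚ :=
  ∏ j ∈ Finset.range n, (1 - A * Q ^ j)

/-- The generalized q-binomial polynomial `[m, z choose n]_q`. -/
noncomputable def qbinomPoly (m n : ℕ) : Polynomial (RatFunc ℚ) :=
  Polynomial.C (qfact n)⁻¹ *
    ∏ k ∈ Finset.Icc ((m : ℤ) - n + 1) (m : ℤ),
      (Polynomial.C (qint k) + Polynomial.C (q ^ k) * Polynomial.X)

/-- The polynomial `(q(1-(1-q)z); q)_k` in the variable `z`. -/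
noncomputable def pochPoly (k : ℕ) : Polynomial (RatFunc ℚ) :=
  ∏ j ∈ Finset.range k,
    (1 - Polynomial.C q * (1 - Polynomial.C (1 - q) * Polynomial.X) * Polynomial.C q ^ j)

/-- The specialized (rescaled, shifted) big q-Jacobi polynomials `P_{ℓ,n}(z)`. -/
noncomputable def bigP (ℓ n : ℕ) : Polynomial (RatFunc ℚ) :=
  Polynomial.C ((-1) ^ n * qPoch q (q ^ (ℓ + 1)) n /
      (q ^ n * (1 - q) ^ n * qPoch q (-q ^ (n + ℓ + 1)) n)) *
    ∑ k ∈ Finset.range (n + 1),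
      Polynomial.C (qPoch q (q ^ (-(n : ℤ))) k * qPoch q (-q ^ (n + ℓ + 1)) k * q ^ k /
          (qPoch q q k * qPoch q (q ^ (ℓ + 1)) k)) * pochPoly k

theorem q_ne_zero : q ≠ 0 := RatFunc.X_ne_zero

theorem q_pow_succ_ne_one (j : ℕ) : q ^ (j + 1) ≠ 1 := by
  intro h
  have hX : (Polynomial.X : Polynomial ℚ) ^ (j + 1) = 1 := by
    apply RatFunc.algebraMap_injective ℚ
    rw [map_pow, RatFunc.algebraMap_X, map_one]
    exact h
  have hdeg := congrArg Polynomial.natDegree hX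
  rw [Polynomial.natDegree_X_pow, Polynomial.natDegree_one] at hdeg
  omega

theorem one_sub_q_ne_zero : 1 - q ≠ 0 := by
  have h := q_pow_succ_ne_one 0
  rw [zero_add, pow_one] at h
  exact sub_ne_zero.mpr h.symm

theorem one_sub_q_pow_succ_ne_zero (j : ℕ) : 1 - q ^ (j + 1) ≠ 0 :=
  sub_ne_zero.mpr (q_pow_succ_ne_one j).symm

theorem one_add_q_pow_succ_ne_zero (j : ℕ) : 1 + q ^ (j + 1) ≠ 0 := by
  intro h
  apply q_pow_succ_ne_one (2 * j + 1)
  linear_combination (q ^ (j + 1) - 1) * h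

theorem qPoch_zero (Q A : RatFunc ℚ) : qPoch Q A 0 = 1 := by
  simp [qPoch]

theorem qPoch_succ (Q A : RatFunc ℚ) (n : ℕ) :
    qPoch Q A (n + 1) = qPoch Q A n * (1 - A * Q ^ n) :=
  Finset.prod_range_succ _ _

theorem qPoch_succ_left (Q A : RatFunc ℚ) (n : ℕ) :
    qPoch Q A (n + 1) = (1 - A) * qPoch Q (A * Q) n := by
  unfold qPoch
  rw [Finset.prod_range_succ', mul_comm, pow_zero, mul_one]
  simp only [pow_succ', mul_assoc]

theorem qPoch_q_q_ne_zero (n : ℕ) : qPoch q q n ≠ 0 :=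
  Finset.prod_ne_zero_iff.mpr fun j _ => by
    rw [← pow_succ']
    exact one_sub_q_pow_succ_ne_zero j

theorem qPoch_neg_q_pow_succ_ne_zero (i n : ℕ) : qPoch q (-q ^ (i + 1)) n ≠ 0 :=
  Finset.prod_ne_zero_iff.mpr fun j _ => by
    have h := one_add_q_pow_succ_ne_zero (i + j)
    rwa [show 1 - -q ^ (i + 1) * q ^ j = 1 + q ^ (i + j + 1) by ring]

/-- Indefinite summation of the series `₂φ₁(A, B; ABQ; Q, Q)`. -/
theorem sum_range_qPoch (Q A B : RatFunc ℚ) (hQ : ∀ n, qPoch Q Q n ≠ 0)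
    (hAB : ∀ n, qPoch Q (A * B * Q) n ≠ 0) (m : ℕ) :
    ∑ k ∈ Finset.range (m + 1),
        qPoch Q A k * qPoch Q B k * Q ^ k / (qPoch Q Q k * qPoch Q (A * B * Q) k) =
      qPoch Q (A * Q) m * qPoch Q (B * Q) m / (qPoch Q Q m * qPoch Q (A * B * Q) m) := by
  induction m with
  | zero => simp [qPoch_zero]
  | succ m ih =>
    rw [Finset.sum_range_succ, ih, qPoch_succ_left Q A, qPoch_succ_left Q B]
    have h1 := hQ (m + 1)
    have h2 := hAB (m + 1)
    rw [qPoch_succ] at h1 h2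
    simp only [qPoch_succ]
    have h1l := left_ne_zero_of_mul h1
    have h1r := right_ne_zero_of_mul h1
    have h2l := left_ne_zero_of_mul h2
    have h2r := right_ne_zero_of_mul h2
    rw [div_add_div _ _ (mul_ne_zero h1l h2l) (mul_ne_zero h1 h2),
      div_eq_div_iff (mul_ne_zero (mul_ne_zero h1l h2l) (mul_ne_zero h1 h2)) (mul_ne_zero h1 h2)]
    ring

theorem qPoch_q_zpow_eq_zero (n : ℕ) : qPoch q (q ^ (-((n + 1 : ℕ) : ℤ)) * q) (n + 1) = 0 := by
  rw [qPoch_succ, mul_assoc, ← pow_succ', zpow_neg, zpow_natCast,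
    inv_mul_cancel₀ (pow_ne_zero _ q_ne_zero), sub_self, mul_zero]

theorem qint_succ (n : ℕ) : qint ((n : ℤ) + 1) = (1 - q ^ (n + 1)) / (1 - q) := by
  unfold qint
  norm_cast

theorem qint_succ_ne_zero (n : ℕ) : qint ((n : ℤ) + 1) ≠ 0 := by
  rw [qint_succ]
  exact div_ne_zero (one_sub_q_pow_succ_ne_zero n) one_sub_q_ne_zero

theorem qbinomPoly_self_zero : qbinomPoly 0 0 = 1 := by
  simp [qbinomPoly, qfact]

theorem C_qint_mul_qbinomPoly_self_succ (n : ℕ) :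
    C (qint ((n : ℤ) + 1)) * qbinomPoly (n + 1) (n + 1) =
      qbinomPoly n n * (C (qint ((n : ℤ) + 1)) + C (q ^ (n + 1)) * X) := by
  have hIcc : Finset.Icc (((n + 1 : ℕ) : ℤ) - (n + 1 : ℕ) + 1) ((n + 1 : ℕ) : ℤ) =
      insert ((n : ℤ) + 1) (Finset.Icc ((n : ℤ) - n + 1) (n : ℤ)) := by
    ext k
    simp only [Finset.mem_Icc, Finset.mem_insert]
    omega
  have hfact : qint ((n : ℤ) + 1) * (qfact (n + 1))⁻¹ = (qfact n)⁻¹ := by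
    rw [qfact, Finset.prod_range_succ, ← qfact, mul_inv_rev,
      mul_inv_cancel_left₀ (qint_succ_ne_zero n)]
  have hpow : q ^ ((n : ℤ) + 1) = q ^ (n + 1) := by norm_cast
  unfold qbinomPoly
  rw [hIcc, Finset.prod_insert (by simp), ← mul_assoc, ← C_mul, hfact, hpow]
  ring

theorem pochPoly_eq (n : ℕ) : pochPoly n = C (qPoch q q n) * qbinomPoly n n := by
  induction n with
  | zero => simp [pochPoly, qPoch_zero, qbinomPoly_self_zero]
  | succ n ih =>
    have hq : q * q ^ n = q ^ (n + 1) := (pow_succ' q n).symm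
    have hint : 1 - q ^ (n + 1) = (1 - q) * qint ((n : ℤ) + 1) := by
      rw [qint_succ, mul_div_cancel₀ _ one_sub_q_ne_zero]
    have hfactor : 1 - C q * (1 - C (1 - q) * X) * C q ^ n =
        C (1 - q) * (C (qint ((n : ℤ) + 1)) + C (q ^ (n + 1)) * X) := by
      rw [mul_add, ← C_mul, ← hint]
      simp only [C_sub, C_1, C_pow]
      ring
    rw [pochPoly, Finset.prod_range_succ, ← pochPoly, ih, hfactor, qPoch_succ, hq, hint,
      C_mul, C_mul]
    linear_combination -C (qPoch q q n) * C (1 - q) * C_qint_mul_qbinomPoly_self_succ n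

theorem map_X_mul_qbinomPoly_self (Φ : Polynomial (RatFunc ℚ) →ₗ[RatFunc ℚ] RatFunc ℚ)
    (hΦ : ∀ n : ℕ, Φ (qbinomPoly n n) = (qPoch q (-q ^ 2) n)⁻¹) (n : ℕ) :
    Φ (X * qbinomPoly n n) = -q * qint ((n : ℤ) + 1) / qPoch q (-q ^ 2) (n + 1) := by
  have hrec : q ^ (n + 1) • (X * qbinomPoly n n) =
      qint ((n : ℤ) + 1) • (qbinomPoly (n + 1) (n + 1) - qbinomPoly n n) := by
    simp only [smul_eq_C_mul]
    linear_combination -C_qint_mul_qbinomPoly_self_succ n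
  have happ := congrArg Φ hrec
  rw [map_smul, map_smul, map_sub, hΦ, hΦ, smul_eq_mul, smul_eq_mul] at happ
  have hpow : q ^ (n + 1) ≠ 0 := pow_ne_zero _ q_ne_zero
  have hsucc := qPoch_neg_q_pow_succ_ne_zero 1 (n + 1)
  rw [one_add_one_eq_two, qPoch_succ, neg_mul, sub_neg_eq_add] at hsucc
  have hl := left_ne_zero_of_mul hsucc
  have hr := right_ne_zero_of_mul hsucc
  apply mul_left_cancel₀ hpow
  rw [happ, qPoch_succ, neg_mul (q ^ 2), sub_neg_eq_add]
  field_simp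
  ring

theorem qPoch_q_q_mul_qint_succ (n : ℕ) :
    qPoch q q n * qint ((n : ℤ) + 1) = qPoch q (q ^ 2) n := by
  have h := (qPoch_succ q q n).symm.trans (qPoch_succ_left q q n)
  rw [← pow_succ', ← sq] at h
  rw [qint_succ, ← mul_div_assoc, h, mul_div_cancel_left₀ _ one_sub_q_ne_zero]

theorem Phi_mul_bigP_one (Φ : Polynomial (RatFunc ℚ) →ₗ[RatFunc ℚ] RatFunc ℚ)
    (hΦ : ∀ n : ℕ, Φ (qbinomPoly n n) = (qPoch q (-q ^ 2) n)⁻¹) :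
    ∀ n : ℕ, 1 ≤ n → Φ (Polynomial.X * bigP 1 n) = 0 := by
  intro n hn
  obtain ⟨n, rfl⟩ := Nat.exists_eq_add_of_le' hn
  set A : RatFunc ℚ := q ^ (-((n + 1 : ℕ) : ℤ)) with hA
  set B : RatFunc ℚ := -q ^ (n + 1 + 1 + 1) with hB
  have hABq : A * B * q = -q ^ 3 := by
    have hcancel : A * q ^ (n + 1) = 1 := by
      rw [hA, zpow_neg, zpow_natCast, inv_mul_cancel₀ (pow_ne_zero _ q_ne_zero)]
    rw [hB]
    linear_combination -q ^ 3 * hcancel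
  have hterm (k : ℕ) :
      Φ (X * (C (qPoch q A k * qPoch q B k * q ^ k / (qPoch q q k * qPoch q (q ^ (1 + 1)) k)) *
        pochPoly k)) =
      -q / (1 + q ^ 2) *
        (qPoch q A k * qPoch q B k * q ^ k / (qPoch q q k * qPoch q (A * B * q) k)) := by
    rw [pochPoly_eq, mul_left_comm X, mul_left_comm X, ← smul_eq_C_mul, ← smul_eq_C_mul,
      map_smul, map_smul, map_X_mul_qbinomPoly_self Φ hΦ, smul_eq_mul, smul_eq_mul,
      one_add_one_eq_two, ← qPoch_q_q_mul_qint_succ, qPoch_succ_left q (-q ^ 2), hABq,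
      show -q ^ 2 * q = -q ^ 3 by ring, sub_neg_eq_add]
    have h1 := qPoch_q_q_ne_zero k
    have h2 := qint_succ_ne_zero k
    have h3 : qPoch q (-q ^ 3) k ≠ 0 := qPoch_neg_q_pow_succ_ne_zero 2 k
    have h4 : 1 + q ^ 2 ≠ 0 := one_add_q_pow_succ_ne_zero 1
    field_simp
  have hsum := sum_range_qPoch q A B qPoch_q_q_ne_zero
    (fun k => hABq ▸ qPoch_neg_q_pow_succ_ne_zero 2 k) (n + 1)
  rw [qPoch_q_zpow_eq_zero, zero_mul, zero_div] at hsum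
  rw [bigP, mul_left_comm, ← smul_eq_C_mul, map_smul, Finset.mul_sum, map_sum,
    Finset.sum_congr rfl fun k _ => hterm k, ← Finset.mul_sum, hsum, mul_zero, smul_zero]
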